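/- arXiv:1509.00092 — 2 statements merged into one kernel-verified Lean document; each statement's English description precedes it below -/
import Mathlib

section
/- For every constant K ≥ 1 there exists a constant C ≥ 1 (depending only on K) such that the following holds. Let n = v·w with v ≤ K·w·2^w, let {P^1,…,P^r} be a collection of partitions of [n] into v blocks of size w, and let 0 < ε < 1. Then for every t-wise independent distribution 𝒟 on {0,1}^n with t ≥ C·w·r·( w + r·log₂(1/ε) + r^2 ), one has | Pr_{x uniform on {0,1}^n}[ ⋁_{α∈[r]} T_{P^α}(x) = 0 ] − Pr_{x∼𝒟}[ ⋁_{α∈[r]} T_{P^α}(x) = 0 ] | ≤ ε. -/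
open Finset

/-- Probability of event `E` under the uniform distribution on a finite type. -/
noncomputable def uPr {α : Type*} [Fintype α] (E : α → Prop) : ℝ :=
  (Nat.card {x // E x} : ℝ) / (Fintype.card α)

-- Probability of event `E` under the distribution with weight function `D`.
open Classical in
noncomputable def dPr {α : Type*} [Fintype α] (D : α → ℝ) (E : α → Prop) : ℝ :=
  ∑ x, if E x then D x else 0

-- `D` is a `t`-wise independent distribution: every projection to ≤ `t` coordinates is uniform.
open Classical in
def kWiseIndep {ι : Type*} [Fintype ι] (D : (ι → Bool) → ℝ) (t : ℕ) : Prop :=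
  ∀ I : Finset ι, I.card ≤ t → ∀ σ : ι → Bool,
    (∑ x : ι → Bool, if ∀ i ∈ I, x i = σ i then D x else 0) = (1/2 : ℝ) ^ I.card

/-- The Tribes event for the partition with blocks `P j`. -/
def TribesP {n v : ℕ} (P : Fin v → Finset (Fin n)) (x : Fin n → Bool) : Prop :=
  ∃ j, ∀ k ∈ P j, x k = true

open Classical in
/-- The real-valued indicator that the conjunction of the variables in `B` is satisfied. -/
noncomputable def termInd {κ : Type*} (B : Finset κ) (x : κ → Bool) : ℝ :=
  if ∀ k ∈ B, x k = true then 1 else 0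

/-- The number of satisfied terms of the monotone DNF with terms `A i`. -/
noncomputable def termCount {ι κ : Type*} [Fintype ι] (A : ι → Finset κ) (x : κ → Bool) : ℝ :=
  ∑ i, termInd (A i) x

/-- The weight function of the uniform distribution on `κ → Bool`. -/
noncomputable def unifWeight (κ : Type*) [Fintype κ] (_ : κ → Bool) : ℝ :=
  (1 / 2) ^ Fintype.card κ

theorem prod_termInd {ι κ : Type*} [DecidableEq κ] (s : Finset ι) (A : ι → Finset κ) (x : κ → Bool) :
    ∏ i ∈ s, termInd (A i) x = termInd (s.biUnion A) x := by
  classical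
  unfold termInd
  rw [Finset.prod_ite_zero]
  simp only [Finset.prod_const_one]
  congr 1
  simp only [Finset.mem_biUnion, eq_iff_iff]
  grind

theorem exists_termCount_eq_natCast {ι κ : Type*} [Fintype ι] (A : ι → Finset κ) (x : κ → Bool) :
    ∃ m : ℕ, termCount A x = m ∧ (m = 0 ↔ ¬ ∃ i, ∀ k ∈ A i, x k = true) := by
  classical
  refine ⟨#{i | ∀ k ∈ A i, x k = true}, ?_, ?_⟩
  · simp [termCount, termInd]
  · simp [Finset.filter_eq_empty_iff]

theorem sum_mul_termInd {κ : Type*} [Fintype κ] [DecidableEq κ] {D : (κ → Bool) → ℝ} {t : ℕ}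
    (hD : kWiseIndep D t) {B : Finset κ} (hB : B.card ≤ t) :
    ∑ x, D x * termInd B x = (1 / 2) ^ B.card := by
  classical
  rw [← hD B hB fun _ => true]
  refine Finset.sum_congr (by congr!) fun x _ => ?_
  unfold termInd
  split_ifs <;> simp_all

theorem kWiseIndep_unifWeight (κ : Type*) [Fintype κ] [DecidableEq κ] (t : ℕ) :
    kWiseIndep (unifWeight κ) t := by
  classical
  intro I _ σ
  have hcard : #{x : κ → Bool | ∀ i ∈ I, x i = σ i} = 2 ^ (Fintype.card κ - #I) := by
    have : ({x : κ → Bool | ∀ i ∈ I, x i = σ i} : Finset (κ → Bool)) =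
        Fintype.piFinset fun i => if i ∈ I then {σ i} else Finset.univ := by
      ext x
      simp only [Finset.mem_filter, Finset.mem_univ, true_and, Fintype.mem_piFinset]
      refine forall_congr' fun i => ?_
      split_ifs <;> simp_all
    rw [this, Fintype.card_piFinset]
    have h2 : ∀ i, #(if i ∈ I then {σ i} else Finset.univ : Finset Bool) =
        if i ∈ I then 1 else 2 := by
      intro i; split_ifs <;> simp
    simp only [h2]
    rw [Finset.prod_ite]
    simp [Finset.filter_not, Finset.card_sdiff]
  have hle : #I ≤ Fintype.card κ := Finset.card_le_univ I
  have hsum : (∑ x : κ → Bool, if ∀ i ∈ I, x i = σ i then unifWeight κ x else 0) =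
      (1 / 2 : ℝ) ^ #I := by
    rw [← Finset.sum_filter]
    simp only [unifWeight, Finset.sum_const, nsmul_eq_mul]
    rw [hcard]
    push_cast
    obtain ⟨c, hc⟩ := Nat.exists_eq_add_of_le hle
    rw [hc, Nat.add_sub_cancel_left, pow_add, mul_left_comm, ← mul_pow]
    norm_num
  rw [← hsum]
  exact Finset.sum_congr (by congr!) fun x _ => by congr

theorem sum_unifWeight (κ : Type*) [Fintype κ] [DecidableEq κ] : ∑ x, unifWeight κ x = 1 := by
  classical
  simp [unifWeight]

theorem uPr_eq_dPr_unifWeight {κ : Type*} [Fintype κ] [DecidableEq κ] (E : (κ → Bool) → Prop) :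
    uPr E = dPr (unifWeight κ) E := by
  classical
  simp only [uPr, dPr, unifWeight, Nat.card_eq_fintype_card, Fintype.card_subtype]
  rw [← Finset.sum_filter, Finset.sum_const, nsmul_eq_mul, Fintype.card_eq_nat_card,
    Nat.card_fun]
  simp [div_eq_mul_inv]

theorem sum_mul_termCount_pow {ι κ : Type*} [Fintype ι] [Fintype κ] [DecidableEq κ] {D : (κ → Bool) → ℝ} {t w : ℕ}
    (hD : kWiseIndep D t) {A : ι → Finset κ} (hA : ∀ i, #(A i) ≤ w) {d : ℕ} (hd : d * w ≤ t) :
    ∑ x, D x * termCount A x ^ d = ∑ f : Fin d → ι,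
      (1 / 2 : ℝ) ^ #(Finset.univ.biUnion fun i => A (f i)) := by
  classical
  simp only [termCount, Fintype.sum_pow, Finset.mul_sum]
  rw [Finset.sum_comm]
  refine Finset.sum_congr rfl fun f _ => ?_
  simp only [prod_termInd]
  refine sum_mul_termInd hD (le_trans ?_ hd)
  simpa using Finset.card_biUnion_le_card_mul Finset.univ (fun i => A (f i)) w fun i _ => hA _

theorem sum_mul_eval_termCount_congr {ι κ : Type*} [Fintype ι] [Fintype κ] [DecidableEq κ]
    {D D' : (κ → Bool) → ℝ} {t w : ℕ} (hD : kWiseIndep D t) (hD' : kWiseIndep D' t)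
    {A : ι → Finset κ} (hA : ∀ i, #(A i) ≤ w) {p : Polynomial ℝ} (hp : p.natDegree * w ≤ t) :
    ∑ x, D x * p.eval (termCount A x) = ∑ x, D' x * p.eval (termCount A x) := by
  simp only [Polynomial.eval_eq_sum_range, Finset.mul_sum]
  rw [Finset.sum_comm, Finset.sum_comm (s := Finset.univ)]
  refine Finset.sum_congr rfl fun d hd => ?_
  have hd' : d * w ≤ t :=
    (Nat.mul_le_mul_right w (Nat.lt_succ_iff.mp (Finset.mem_range.mp hd))).trans hp
  simp only [mul_left_comm _ (p.coeff d), ← Finset.mul_sum]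
  rw [sum_mul_termCount_pow hD hA hd', sum_mul_termCount_pow hD' hA hd']

theorem abs_dPr_sub_dPr_le {ι κ : Type*} [Fintype ι] [Fintype κ] [DecidableEq κ]
    {D D' : (κ → Bool) → ℝ} {t w : ℕ} (h0 : ∀ x, 0 ≤ D x) (h0' : ∀ x, 0 ≤ D' x)
    (hD : kWiseIndep D t) (hD' : kWiseIndep D' t)
    {A : ι → Finset κ} (hA : ∀ i, #(A i) ≤ w) {q : Polynomial ℝ} (hq0 : q.eval 0 = 1)
    (hq : (2 * q.natDegree + 1) * w ≤ t) :
    |dPr D (fun x => ¬ ∃ i, ∀ k ∈ A i, x k = true) -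
      dPr D' (fun x => ¬ ∃ i, ∀ k ∈ A i, x k = true)| ≤
      ∑ x, D x * (termCount A x * q.eval (termCount A x) ^ 2) := by
  classical
  have hsand : ∀ {D : (κ → Bool) → ℝ}, (∀ x, 0 ≤ D x) →
      ∑ x, D x * ((1 - Polynomial.X) * q ^ 2).eval (termCount A x) ≤
        dPr D (fun x => ¬ ∃ i, ∀ k ∈ A i, x k = true) ∧
      dPr D (fun x => ¬ ∃ i, ∀ k ∈ A i, x k = true) ≤
        ∑ x, D x * (q ^ 2).eval (termCount A x) := by
    intro D h0
    unfold dPr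
    constructor <;> refine Finset.sum_le_sum fun x _ => ?_ <;>
      obtain ⟨m, hm, hm0⟩ := exists_termCount_eq_natCast A x <;> rw [hm]
    · split_ifs with h
      · simp [hm0.mpr h, hq0]
      · have : (1 : ℝ) ≤ m := by
          exact_mod_cast Nat.one_le_iff_ne_zero.mpr fun h' => h (hm0.mp h')
        simp only [Polynomial.eval_mul, Polynomial.eval_sub, Polynomial.eval_one,
          Polynomial.eval_X, Polynomial.eval_pow]
        nlinarith [mul_nonneg (h0 x) (mul_nonneg (sub_nonneg.mpr this) (sq_nonneg (q.eval (m : ℝ))))]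
    · split_ifs with h
      · simp [hm0.mpr h, hq0]
      · rw [Polynomial.eval_pow]
        exact mul_nonneg (h0 x) (sq_nonneg _)
  have hdeg2 : (q ^ 2).natDegree ≤ 2 * q.natDegree := Polynomial.natDegree_pow_le
  have hdeg : ((1 - Polynomial.X) * q ^ 2).natDegree ≤ 2 * q.natDegree + 1 := by
    refine Polynomial.natDegree_mul_le.trans ?_
    have : (1 - Polynomial.X : Polynomial ℝ).natDegree ≤ 1 := by
      refine (Polynomial.natDegree_sub_le _ _).trans ?_
      simp
    omega
  have e1 := sum_mul_eval_termCount_congr hD hD' hA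
    (p := q ^ 2) (le_trans (Nat.mul_le_mul_right w (by omega)) hq)
  have e2 := sum_mul_eval_termCount_congr hD hD' hA
    (p := (1 - Polynomial.X) * q ^ 2) (le_trans (Nat.mul_le_mul_right w hdeg) hq)
  have e3 : ∑ x, D x * (termCount A x * q.eval (termCount A x) ^ 2) =
      ∑ x, D x * (q ^ 2).eval (termCount A x) -
      ∑ x, D x * ((1 - Polynomial.X) * q ^ 2).eval (termCount A x) := by
    rw [← Finset.sum_sub_distrib]
    refine Finset.sum_congr rfl fun x _ => ?_
    simp only [Polynomial.eval_mul, Polynomial.eval_sub, Polynomial.eval_one,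
          Polynomial.eval_X, Polynomial.eval_pow]
    ring
  obtain ⟨l, u⟩ := hsand h0
  obtain ⟨l', u'⟩ := hsand h0'
  rw [abs_le]
  constructor <;> linarith

theorem sum_unifWeight_mul_exp_termCount_le {ι κ : Type*} [Fintype ι] [Fintype κ] [DecidableEq κ]
    {A : ι → Finset κ} {w : ℕ} (hA : ∀ i, #(A i) = w)
    (hdisj : ∀ i j, i ≠ j → Disjoint (A i) (A j)) :
    ∑ x, unifWeight κ x * Real.exp (termCount A x) ≤
      Real.exp (Fintype.card ι * ((Real.exp 1 - 1) * (1 / 2) ^ w)) := by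
  classical
  have hexp : ∀ x, Real.exp (termCount A x) =
      ∑ s : Finset ι, (Real.exp 1 - 1) ^ #s * termInd (s.biUnion A) x := by
    intro x
    rw [termCount, Real.exp_sum]
    have : ∀ i, Real.exp (termInd (A i) x) = 1 + (Real.exp 1 - 1) * termInd (A i) x := by
      intro i
      unfold termInd
      split_ifs <;> simp
    simp only [this]
    rw [Finset.prod_one_add, Finset.powerset_univ]
    refine Finset.sum_congr rfl fun s _ => ?_
    rw [Finset.prod_mul_distrib, Finset.prod_const, prod_termInd]
  simp only [hexp, Finset.mul_sum]
  rw [Finset.sum_comm]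
  have hs : ∀ s : Finset ι, ∑ x, unifWeight κ x * ((Real.exp 1 - 1) ^ #s *
      termInd (s.biUnion A) x) = ∏ i ∈ s, ((Real.exp 1 - 1) * (1 / 2) ^ w) := by
    intro s
    simp only [mul_left_comm _ ((Real.exp 1 - 1) ^ #s), ← Finset.mul_sum]
    rw [sum_mul_termInd (kWiseIndep_unifWeight κ _) le_rfl,
      Finset.card_biUnion fun i _ j _ h => hdisj i j h]
    simp [hA, mul_pow, ← pow_mul, mul_comm]
  simp only [hs]
  rw [← Finset.powerset_univ, ← Finset.prod_one_add]
  refine (Real.prod_one_add_le_exp_sum _ fun i => ?_).trans ?_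
  · have := Real.add_one_le_exp (1 : ℝ)
    have : 0 ≤ Real.exp 1 - 1 := by linarith
    positivity
  · simp

theorem sum_unifWeight_mul_exp_average_le {κ : Type*} [Fintype κ] [DecidableEq κ] {r v w : ℕ} (hr : 0 < r)
    {P : Fin r → Fin v → Finset κ} (hP : ∀ α j, #(P α j) = w)
    (hdisj : ∀ α i j, i ≠ j → Disjoint (P α i) (P α j)) :
    ∑ x, unifWeight κ x *
        Real.exp (termCount (fun c : Fin r × Fin v => P c.1 c.2) x / r) ≤
      Real.exp (v * ((Real.exp 1 - 1) * (1 / 2) ^ w)) := by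
  have hr' : (0 : ℝ) < r := by exact_mod_cast hr
  have hconv : ∀ x, Real.exp (termCount (fun c : Fin r × Fin v => P c.1 c.2) x / r) ≤
      ∑ α, (1 / r : ℝ) * Real.exp (termCount (P α) x) := by
    intro x
    have := convexOn_exp.map_sum_le (t := Finset.univ) (w := fun _ : Fin r => (1 / r : ℝ))
      (p := fun α => termCount (P α) x) (fun _ _ => by positivity)
      (by simp [hr'.ne']) (fun _ _ => Set.mem_univ _)
    simp only [smul_eq_mul] at this
    refine le_trans (le_of_eq ?_) this
    rw [← Finset.mul_sum]
    simp only [termCount, Fintype.sum_prod_type]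
    congr 1
    ring
  calc _ ≤ ∑ x, unifWeight κ x * ∑ α, (1 / r : ℝ) * Real.exp (termCount (P α) x) :=
        Finset.sum_le_sum fun x _ => mul_le_mul_of_nonneg_left (hconv x)
          (by unfold unifWeight; positivity)
    _ = ∑ α : Fin r, (1 / r : ℝ) * ∑ x, unifWeight κ x * Real.exp (termCount (P α) x) := by
        simp only [Finset.mul_sum]
        rw [Finset.sum_comm]
        exact Finset.sum_congr rfl fun _ _ => Finset.sum_congr rfl fun _ _ => by ring
    _ ≤ ∑ α : Fin r, (1 / r : ℝ) * Real.exp (v * ((Real.exp 1 - 1) * (1 / 2) ^ w)) := by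
        gcongr with α
        simpa using sum_unifWeight_mul_exp_termCount_le (hP α) (hdisj α)
    _ = _ := by
        rw [← Finset.sum_mul]
        simp [hr'.ne']

theorem abs_eval_chebyshevT_le {y Y : ℝ} (hy : |y| ≤ Y) (hY : 1 ≤ Y) (n : ℕ) :
    |(Polynomial.Chebyshev.T ℝ n).eval y| ≤ (3 * Y) ^ n := by
  induction n using Nat.twoStepInduction with
  | zero => simp
  | one => simp; linarith
  | more n ih ih' =>
    push_cast at ih' ⊢
    rw [Polynomial.Chebyshev.T_add_two]
    simp only [Polynomial.eval_sub, Polynomial.eval_mul, Polynomial.eval_X, Polynomial.eval_ofNat]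
    have hpos : 0 < (3 * Y) ^ n := by positivity
    calc _ ≤ |2 * y * (Polynomial.Chebyshev.T ℝ (n + 1)).eval y| +
            |(Polynomial.Chebyshev.T ℝ n).eval y| := abs_sub _ _
      _ ≤ 2 * Y * (3 * Y) ^ (n + 1) + (3 * Y) ^ n := by
          rw [abs_mul, abs_mul, abs_two]
          gcongr
      _ ≤ (3 * Y) ^ (n + 2) := by
          rw [pow_succ, pow_add]
          nlinarith [mul_nonneg hpos.le (by nlinarith : 0 ≤ 3 * Y ^ 2 - 1)]

theorem cosh_one_div_sub_one_le {s : ℝ} (hs : 1 ≤ s) : Real.cosh (1 / s) - 1 ≤ 1 / s ^ 2 := by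
  have h1 : (1 / s) ^ 2 / 2 ≤ 1 / 2 := by
    have : 1 / s ≤ 1 := by rw [div_le_one (by linarith)]; exact hs
    have : (1 / s) ^ 2 ≤ 1 := pow_le_one₀ (by positivity) this
    linarith
  have h0 : 0 ≤ (1 / s) ^ 2 / 2 := by positivity
  have h2 := Real.abs_exp_sub_one_le (x := (1 / s) ^ 2 / 2) (by rw [abs_of_nonneg h0]; linarith)
  have h3 := Real.cosh_le_exp_half_sq (1 / s)
  rw [abs_of_nonneg h0] at h2
  have h4 := le_abs_self (Real.exp ((1 / s) ^ 2 / 2) - 1)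
  have h5 : (1 / s) ^ 2 = 1 / s ^ 2 := by rw [one_div_pow]
  linarith

theorem exists_polynomial_small_on_Icc {a s : ℝ} (ha : 0 < a) (hs : 1 ≤ s) (b : ℕ) :
    ∃ p : Polynomial ℝ, p.natDegree ≤ b ∧ p.eval 0 = 1 ∧
      (∀ x, a ≤ x → x ≤ 2 * a * s ^ 2 → p.eval x ^ 2 ≤ 4 * Real.exp (-(2 * (b / s)))) ∧
      ∀ x, a ≤ x → p.eval x ^ 2 ≤ 9 ^ b * Real.exp (2 * (b * (x / (a * s ^ 2)))) := by
  set c := Real.cosh (1 / s) with hc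
  have hc1 : 1 ≤ c := Real.one_le_cosh _
  have hcs : c - 1 ≤ 1 / s ^ 2 := cosh_one_div_sub_one_le hs
  set ℓ : Polynomial ℝ := Polynomial.C c - Polynomial.C ((c - 1) / a) * Polynomial.X with hℓ
  set d := Real.cosh (b * (1 / s)) with hd
  have hd1 : 1 ≤ d := Real.one_le_cosh _
  have hde : Real.exp (b / s) / 2 ≤ d := by
    rw [hd, Real.cosh_eq, mul_one_div]
    have := Real.exp_pos (-(b / s))
    linarith
  have hev : ∀ x, (Polynomial.C d⁻¹ * (Polynomial.Chebyshev.T ℝ b).comp ℓ).eval x =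
      d⁻¹ * (Polynomial.Chebyshev.T ℝ b).eval (c - (c - 1) / a * x) := by
    intro x
    simp [hℓ, Polynomial.eval_comp]
  have hy : ∀ x, c - (c - 1) / a * x = 1 - (c - 1) * ((x - a) / a) := by
    intro x
    field_simp
    ring
  refine ⟨Polynomial.C d⁻¹ * (Polynomial.Chebyshev.T ℝ b).comp ℓ, ?_, ?_, ?_, ?_⟩
  · refine (Polynomial.natDegree_C_mul_le _ _).trans ?_
    refine Polynomial.natDegree_comp_le.trans ?_
    rw [Polynomial.Chebyshev.natDegree_T]
    have : ℓ.natDegree ≤ 1 := by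
      refine (Polynomial.natDegree_sub_le _ _).trans ?_
      rw [Polynomial.natDegree_C]
      exact max_le (by simp) ((Polynomial.natDegree_C_mul_le _ _).trans Polynomial.natDegree_X_le)
    simpa using Nat.mul_le_mul_left b this
  · have := Polynomial.Chebyshev.T_real_cosh (1 / s) b
    rw [hev, mul_zero, sub_zero, hc, this]
    push_cast
    rw [← hd, inv_mul_cancel₀ (by positivity)]
  · intro x hax hx
    rw [hev, hy]
    have h0 : 0 ≤ (x - a) / a := div_nonneg (by linarith) ha.le
    have h1 : (c - 1) * ((x - a) / a) ≤ 2 := by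
      calc (c - 1) * ((x - a) / a) ≤ 1 / s ^ 2 * ((2 * a * s ^ 2) / a) := by
            gcongr
            linarith
        _ = 2 := by field_simp
    have h2 := Polynomial.Chebyshev.abs_eval_T_real_le_one b
      (x := 1 - (c - 1) * ((x - a) / a)) (by
        rw [abs_le]
        constructor
        · linarith
        · nlinarith [mul_nonneg (sub_nonneg.mpr hc1) h0])
    rw [mul_pow]
    have h3 := (sq_le_one_iff_abs_le_one _).mpr h2
    have h4 : d⁻¹ ≤ 2 * Real.exp (-(b / s)) := by
      rw [Real.exp_neg, ← div_eq_mul_inv]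
      rw [inv_le_comm₀ (by positivity) (by positivity), inv_div]
      exact hde
    calc _ ≤ (2 * Real.exp (-(b / s))) ^ 2 * 1 := by gcongr
      _ = _ := by
        rw [mul_one, mul_pow, ← Real.exp_nat_mul]
        norm_num
  · intro x hax
    rw [hev, hy]
    have h0 : 0 ≤ (x - a) / a := div_nonneg (by linarith) ha.le
    have hx0 : 0 ≤ x := ha.le.trans hax
    have h1 : (c - 1) * ((x - a) / a) ≤ x / (a * s ^ 2) := by
      calc (c - 1) * ((x - a) / a) ≤ 1 / s ^ 2 * (x / a) := by
            gcongr
            linarith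
        _ = _ := by field_simp
    have h1' := mul_nonneg (sub_nonneg.mpr hc1) h0
    have h2 := abs_eval_chebyshevT_le (y := 1 - (c - 1) * ((x - a) / a))
      (Y := 1 + x / (a * s ^ 2)) (by rw [abs_le]; constructor <;> linarith) (by linarith) b
    have h3 : d⁻¹ ≤ 1 := inv_le_one_of_one_le₀ hd1
    rw [mul_pow, ← sq_abs (Polynomial.eval _ _)]
    calc _ ≤ 1 ^ 2 * ((3 * (1 + x / (a * s ^ 2))) ^ b) ^ 2 := by gcongr
      _ ≤ 1 ^ 2 * ((3 * Real.exp (x / (a * s ^ 2))) ^ b) ^ 2 := by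
        gcongr
        linarith [Real.add_one_le_exp (x / (a * s ^ 2))]
      _ = _ := by
        rw [one_pow, one_mul, ← pow_mul, mul_pow, ← Real.exp_nat_mul, mul_comm b 2, pow_mul]
        norm_num
        ring_nf

theorem exists_polynomial_zeros (a : ℕ) :
    ∃ p : Polynomial ℝ, p.natDegree ≤ a ∧ p.eval 0 = 1 ∧
      (∀ x : ℕ, x ≠ 0 → x ≤ a → p.eval (x : ℝ) = 0) ∧
      ∀ x : ℝ, a ≤ x → |p.eval x| ≤ x ^ a / a.factorial := by
  refine ⟨∏ j ∈ Finset.range a, (1 - Polynomial.C (1 / ((j : ℝ) + 1)) * Polynomial.X),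
    ?_, ?_, ?_, ?_⟩
  · refine (Polynomial.natDegree_prod_le _ _).trans ?_
    refine (Finset.sum_le_card_nsmul _ _ 1 fun j _ => ?_).trans (by simp)
    refine (Polynomial.natDegree_sub_le _ _).trans ?_
    exact max_le (by simp) ((Polynomial.natDegree_C_mul_le _ _).trans Polynomial.natDegree_X_le)
  · simp [Polynomial.eval_prod]
  · intro x hx0 hxa
    rw [Polynomial.eval_prod]
    refine Finset.prod_eq_zero (i := x - 1) (Finset.mem_range.mpr (by omega)) ?_
    have : ((x - 1 : ℕ) : ℝ) + 1 = x := by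
      rw [Nat.cast_sub (by omega)]; simp
    have hx : (x : ℝ) ≠ 0 := by exact_mod_cast hx0
    simp [this, hx]
  · intro x hx
    have : x ^ a / a.factorial = ∏ j ∈ Finset.range a, (x / ((j : ℝ) + 1)) := by
      rw [Finset.prod_div_distrib, Finset.prod_const, Finset.card_range,
        ← Finset.prod_range_add_one_eq_factorial]
      push_cast
      rfl
    rw [this, Polynomial.eval_prod, Finset.abs_prod]
    refine Finset.prod_le_prod (fun _ _ => abs_nonneg _) fun j hj => ?_
    have hj' : (j : ℝ) + 1 ≤ a := by exact_mod_cast Finset.mem_range.mp hj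
    have h1 : 1 ≤ x / ((j : ℝ) + 1) := by
      rw [one_le_div (by positivity)]
      linarith
    simp only [Polynomial.eval_sub, Polynomial.eval_one, Polynomial.eval_mul, Polynomial.eval_C,
      Polynomial.eval_X, one_div_mul_eq_div]
    rw [abs_le]
    constructor <;> linarith

theorem pow_div_factorial_le_mul_exp {x y : ℝ} (hx : 0 ≤ x) (hy : 0 < y) (a : ℕ) :
    x ^ a / a.factorial ≤ y ^ a * Real.exp (x / y) := by
  have := Real.pow_div_factorial_le_exp (x / y) (div_nonneg hx hy.le) a
  calc x ^ a / a.factorial = y ^ a * ((x / y) ^ a / a.factorial) := by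
        rw [div_pow]; field_simp
    _ ≤ _ := by gcongr

theorem le_mul_exp_div {x y : ℝ} (hy : 0 < y) : x ≤ y * Real.exp (x / y) := by
  have := Real.add_one_le_exp (x / y)
  calc x = y * (x / y) := by field_simp
    _ ≤ _ := by gcongr; linarith

theorem exists_polynomial_weighted_le {K : ℝ} (hK : 0 ≤ K) {N r a : ℕ} (hN : K + 100 ≤ N)
    (hr : 1 ≤ r) (ha : 1 ≤ a) :
    ∃ q : Polynomial ℝ, q.natDegree ≤ a + N ^ 3 * r ^ 3 * a ∧ q.eval 0 = 1 ∧
      ∀ x : ℕ, (x : ℝ) * q.eval (x : ℝ) ^ 2 ≤ 1 / 2 * Real.exp (-(a * r)) +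
        1 / 2 * Real.exp (-(a * r + 2 * K * a * r ^ 2)) * Real.exp (x / r) := by
  have hr' : (1 : ℝ) ≤ r := by exact_mod_cast hr
  have ha' : (1 : ℝ) ≤ a := by exact_mod_cast ha
  have hN' : (100 : ℝ) ≤ N := by linarith
  have hs : (1 : ℝ) ≤ N ^ 2 * r ^ 2 := by
    have h1 : (1 : ℝ) ≤ N ^ 2 := one_le_pow₀ (by linarith)
    have h2 : (1 : ℝ) ≤ r ^ 2 := one_le_pow₀ hr'
    nlinarith
  obtain ⟨A, hAd, hA0, hAz, hAb⟩ := exists_polynomial_zeros a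
  obtain ⟨B, hBd, hB0, hBs, hBb⟩ := exists_polynomial_small_on_Icc
    (a := a) (s := N ^ 2 * r ^ 2) (by linarith) hs (N ^ 3 * r ^ 3 * a)
  have har : (1 : ℝ) ≤ a * r := by nlinarith
  refine ⟨A * B, Polynomial.natDegree_mul_le.trans (by omega), by simp [hA0, hB0], fun x => ?_⟩
  rw [Polynomial.eval_mul, mul_pow]
  rcases Nat.eq_zero_or_pos x with rfl | hx0
  · simp only [Nat.cast_zero, zero_mul]
    positivity
  rcases le_or_gt x a with hxa | hxa
  · rw [hAz x hx0.ne' hxa]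
    simp only [ne_eq, OfNat.ofNat_ne_zero, not_false_eq_true, zero_pow, zero_mul, mul_zero]
    positivity
  have hxa' : (a : ℝ) ≤ x := by exact_mod_cast hxa.le
  have hx' : (0 : ℝ) ≤ x := by positivity
  have hA := hAb x hxa'
  have hA2 : ∀ z, (x : ℝ) ^ a / a.factorial ≤ z → A.eval (x : ℝ) ^ 2 ≤ z ^ 2 := fun z hz =>
    sq_le_sq.mpr (((hA.trans hz).trans (le_abs_self z)))
  rcases le_or_gt (x : ℝ) (2 * a * (N ^ 2 * r ^ 2 : ℝ) ^ 2) with hxL | hxL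
  · refine le_trans ?_ (le_add_of_nonneg_right (by positivity))
    have hB := hBs x hxa' hxL
    push_cast at hB
    have e1 : (N ^ 3 * r ^ 3 * a : ℝ) / (N ^ 2 * r ^ 2) = N * (a * r) := by field_simp
    rw [e1] at hB
    set S : ℝ := 2 * (N ^ 2 * r ^ 2 : ℝ) ^ 2 with hS
    have hS0 : 0 < S := by positivity
    have hSe : S ≤ Real.exp (13 * r + N / 5 * r + 4 * r) := by
      have h20 : (20 : ℝ) ≤ Real.exp 3 := by
        have := Real.exp_one_gt_d9
        calc (20 : ℝ) ≤ 2.7182818283 ^ 3 := by norm_num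
          _ ≤ Real.exp 1 ^ 3 := by gcongr
          _ = _ := by rw [← Real.exp_nat_mul]; norm_num
      have hNe : (N : ℝ) ≤ Real.exp (3 + N / 20) := by
        rw [Real.exp_add]
        exact (le_mul_exp_div (by norm_num : (0 : ℝ) < 20)).trans (by gcongr)
      have hre : (r : ℝ) ≤ Real.exp r := by linarith [Real.add_one_le_exp (r : ℝ)]
      have h2 : (2 : ℝ) ≤ Real.exp 1 := by linarith [Real.add_one_le_exp (1 : ℝ)]
      calc S = 2 * N ^ 4 * r ^ 4 := by rw [hS]; ring
        _ ≤ Real.exp 1 * Real.exp (3 + N / 20) ^ 4 * Real.exp r ^ 4 := by gcongr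
        _ = Real.exp (13 + N / 5 + 4 * r) := by
          rw [← Real.exp_nat_mul, ← Real.exp_nat_mul, ← Real.exp_add, ← Real.exp_add]
          congr 1
          push_cast
          ring
        _ ≤ _ := by
          gcongr
          · linarith
          · exact le_mul_of_one_le_right (by positivity) hr'
    have hxS : (x : ℝ) ≤ S * Real.exp a := by
      calc (x : ℝ) ≤ S * a := by linarith
        _ ≤ _ := by gcongr; linarith [Real.add_one_le_exp (a : ℝ)]
    have hpow : (x : ℝ) ^ a / a.factorial ≤ S ^ a * Real.exp a := by
      refine (pow_div_factorial_le_mul_exp hx' hS0 a).trans ?_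
      gcongr
      rw [div_le_iff₀ hS0]
      linarith
    have hA3 := hA2 _ hpow
    calc (x : ℝ) * (A.eval (x : ℝ) ^ 2 * B.eval (x : ℝ) ^ 2)
        ≤ S * Real.exp a * ((S ^ a * Real.exp a) ^ 2 * (4 * Real.exp (-(2 * (N * (a * r)))))) := by
          gcongr
      _ = S ^ (2 * a + 1) * (1 / 2 * (8 * Real.exp (3 * a - 2 * (N * (a * r))))) := by
          rw [show (3 * a - 2 * (N * (a * r)) : ℝ) = a + (a + a) + -(2 * (N * (a * r))) by ring]
          simp only [Real.exp_add]
          ring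
      _ ≤ Real.exp (13 * r + N / 5 * r + 4 * r) ^ (3 * a) *
          (1 / 2 * (Real.exp 7 * Real.exp (3 * a - 2 * (N * (a * r))))) := by
          have h1 : S ^ (2 * a + 1) ≤ Real.exp (13 * r + N / 5 * r + 4 * r) ^ (3 * a) := by
            calc _ ≤ Real.exp (13 * r + N / 5 * r + 4 * r) ^ (2 * a + 1) := by gcongr
              _ ≤ _ := pow_le_pow_right₀ (Real.one_le_exp (by positivity)) (by omega)
          have h2 : (8 : ℝ) ≤ Real.exp 7 := by linarith [Real.add_one_le_exp (7 : ℝ)]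
          gcongr
      _ = 1 / 2 * Real.exp (((3 * a : ℕ) : ℝ) * (13 * r + N / 5 * r + 4 * r) +
            (7 + (3 * a - 2 * (N * (a * r))))) := by
          rw [← Real.exp_nat_mul, Real.exp_add, Real.exp_add]
          ring
      _ ≤ _ := by
          gcongr
          push_cast
          nlinarith [mul_le_mul_of_nonneg_right hN' (by linarith : (0 : ℝ) ≤ a * r),
            mul_le_mul_of_nonneg_left hr' (by linarith : (0 : ℝ) ≤ a)]
  · refine le_trans ?_ (le_add_of_nonneg_left (by positivity))
    have hB := hBb x hxa'
    push_cast at hB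
    have e1 : (N ^ 3 * r ^ 3 * a : ℝ) * (x / (a * (N ^ 2 * r ^ 2) ^ 2)) = x / r / N := by
      field_simp
    rw [e1] at hB
    have hr8 : (0 : ℝ) < 8 * r := by positivity
    have h8 : (8 * r : ℝ) ≤ Real.exp (8 * r) := by linarith [Real.add_one_le_exp (8 * r : ℝ)]
    have h9 : (9 : ℝ) ≤ Real.exp 8 := by linarith [Real.add_one_le_exp (8 : ℝ)]
    have hxr : (0 : ℝ) ≤ x / r := by positivity
    have hA3 := hA2 _ (pow_div_factorial_le_mul_exp hx' hr8 a)
    calc (x : ℝ) * (A.eval (x : ℝ) ^ 2 * B.eval (x : ℝ) ^ 2)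
        ≤ 8 * r * Real.exp (x / (8 * r)) * (((8 * r) ^ a * Real.exp (x / (8 * r))) ^ 2 *
          (9 ^ (N ^ 3 * r ^ 3 * a) * Real.exp (2 * (x / r / N)))) := by
          gcongr
          exact le_mul_exp_div hr8
      _ = (8 * r) ^ (2 * a + 1) * 9 ^ (N ^ 3 * r ^ 3 * a) *
          Real.exp (3 / 8 * (x / r) + 2 * (x / r / N)) := by
          rw [show (3 / 8 * (x / r) + 2 * (x / r / N) : ℝ) =
            x / (8 * r) + (x / (8 * r) + x / (8 * r)) + 2 * (x / r / N) by field_simp; ring]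
          simp only [Real.exp_add]
          ring
      _ ≤ Real.exp (8 * r) ^ (3 * a) * Real.exp 8 ^ (N ^ 3 * r ^ 3 * a) *
          Real.exp (1 / 2 * (x / r)) := by
          have h1 : (8 * r : ℝ) ^ (2 * a + 1) ≤ Real.exp (8 * r) ^ (3 * a) := by
            calc _ ≤ Real.exp (8 * r) ^ (2 * a + 1) := by gcongr
              _ ≤ _ := pow_le_pow_right₀ (Real.one_le_exp (by positivity)) (by omega)
          have h2 : (x / r / N : ℝ) ≤ x / r / 100 := by gcongr
          gcongr
          linarith
      _ = Real.exp (((3 * a : ℕ) : ℝ) * (8 * r) + ((N ^ 3 * r ^ 3 * a : ℕ) : ℝ) * 8 +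
            1 / 2 * (x / r)) := by
          rw [← Real.exp_nat_mul, ← Real.exp_nat_mul, ← Real.exp_add, ← Real.exp_add]
      _ ≤ Real.exp (-1 + (-(a * r + 2 * K * a * r ^ 2) + x / r)) := by
          refine Real.exp_le_exp.mpr ?_
          have h1 : (2 * (N ^ 4 * (a * r ^ 3)) : ℝ) ≤ x / r := by
            rw [le_div_iff₀ (by positivity)]
            linarith
          have h2 : (1 : ℝ) ≤ r ^ 2 := one_le_pow₀ hr'
          have h3 : (a * r : ℝ) ≤ a * r ^ 3 := by nlinarith
          have h4 : (a * r ^ 2 : ℝ) ≤ a * r ^ 3 := by nlinarith [sq_nonneg (r : ℝ)]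
          have h5 : K * (a * r ^ 2 : ℝ) ≤ N * (a * r ^ 3) := by
            gcongr
            linarith
          have h6 : (26 + 2 * N + 8 * N ^ 3 : ℝ) ≤ N ^ 4 := by
            have e : (100 : ℝ) * N ^ 3 ≤ N * N ^ 3 := by gcongr
            have e' : (N : ℝ) ≤ N ^ 3 := le_self_pow₀ (by linarith) (by norm_num)
            linarith
          have h7 := mul_le_mul_of_nonneg_right h6 (by positivity : (0 : ℝ) ≤ a * r ^ 3)
          push_cast
          linarith
      _ ≤ _ := by
          rw [Real.exp_add, Real.exp_add, ← mul_assoc]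
          gcongr
          rw [Real.exp_neg, one_div]
          gcongr
          linarith [Real.add_one_le_exp (1 : ℝ)]

theorem mean_mul_exp_le {K : ℝ} {v w : ℕ} (h : (v : ℝ) ≤ K * w * 2 ^ w) :
    v * ((Real.exp 1 - 1) * (1 / 2) ^ w) ≤ 2 * K * w := by
  have h1 : Real.exp 1 - 1 ≤ 2 := by linarith [Real.exp_one_lt_d9]
  have h2 : 0 ≤ Real.exp 1 - 1 := by linarith [Real.add_one_le_exp (1 : ℝ)]
  have h3 : 0 ≤ K * w * 2 ^ w := (Nat.cast_nonneg v).trans h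
  calc (v : ℝ) * ((Real.exp 1 - 1) * (1 / 2) ^ w)
      ≤ (K * w * 2 ^ w) * (2 * (1 / 2) ^ w) := by gcongr
    _ = 2 * K * w * (2 * (1 / 2)) ^ w := by rw [mul_pow]; ring
    _ = 2 * K * w := by norm_num

theorem exists_scale {r w : ℕ} {L : ℝ} (hr : 0 < r) (hL : 0 ≤ L) :
    ∃ a : ℕ, 1 ≤ a ∧ (w : ℝ) ≤ a * r ^ 2 ∧ L ≤ a * r ∧
      (a : ℝ) * r ^ 2 ≤ 2 * (w + r * L + (r : ℝ) ^ 2) := by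
  have hr' : (1 : ℝ) ≤ r := by exact_mod_cast hr
  have hrL : 0 ≤ r * L := by positivity
  have hw : (0 : ℝ) ≤ w := by positivity
  set W : ℝ := w + r * L + (r : ℝ) ^ 2 with hW
  have hW1 : 1 ≤ W / r ^ 2 := by
    rw [one_le_div (by positivity)]
    linarith
  have haW : W / r ^ 2 ≤ ⌈W / r ^ 2⌉₊ := Nat.le_ceil _
  have haW' : (⌈W / r ^ 2⌉₊ : ℝ) ≤ 2 * (W / r ^ 2) := by
    linarith [Nat.ceil_lt_add_one (a := W / (r : ℝ) ^ 2) (by linarith)]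
  have hWa : W ≤ ⌈W / r ^ 2⌉₊ * r ^ 2 := (div_le_iff₀ (by positivity)).mp haW
  have hr2 : (0 : ℝ) ≤ r ^ 2 := by positivity
  refine ⟨⌈W / r ^ 2⌉₊, by exact_mod_cast hW1.trans haW, by linarith, ?_, ?_⟩
  · refine le_of_mul_le_mul_left ?_ (by linarith : (0 : ℝ) < r)
    calc r * L ≤ ⌈W / r ^ 2⌉₊ * r ^ 2 := by linarith
      _ = r * (⌈W / r ^ 2⌉₊ * r) := by ring
  · calc (⌈W / r ^ 2⌉₊ : ℝ) * r ^ 2 ≤ 2 * (W / r ^ 2) * r ^ 2 := by gcongr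
      _ = 2 * W := by field_simp

theorem two_mul_degree_add_one_mul_le {N r w a d t : ℕ} {W : ℝ} (hN : 1 ≤ N) (hr : 1 ≤ r)
    (hW : 1 ≤ W) (ha : (a : ℝ) * r ^ 2 ≤ 2 * W) (hd : d ≤ a + N ^ 3 * r ^ 3 * a)
    (ht : 9 * N ^ 3 * w * r * W ≤ t) : (2 * d + 1) * w ≤ t := by
  have hr' : (1 : ℝ) ≤ r := by exact_mod_cast hr
  have hr2 : (1 : ℝ) ≤ r ^ 2 := one_le_pow₀ hr'
  have hN3 : (1 : ℝ) ≤ N ^ 3 := one_le_pow₀ (by exact_mod_cast hN)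
  have hd' : (d : ℝ) ≤ a + N ^ 3 * r ^ 3 * a := by exact_mod_cast hd
  have h1 : W ≤ N ^ 3 * r * W :=
    le_mul_of_one_le_left (by linarith) (one_le_mul_of_one_le_of_one_le hN3 hr')
  have h2 : (a : ℝ) ≤ a * r ^ 2 := le_mul_of_one_le_right (by positivity) hr2
  have h3 : (N ^ 3 * r ^ 3 * a : ℝ) ≤ 2 * (N ^ 3 * r * W) := by
    calc (N ^ 3 * r ^ 3 * a : ℝ) = N ^ 3 * r * (a * r ^ 2) := by ring
      _ ≤ N ^ 3 * r * (2 * W) := by gcongr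
      _ = _ := by ring
  have h4 : (2 * d + 1 : ℝ) ≤ 9 * (N ^ 3 * r * W) := by linarith
  have h5 : ((2 * d + 1) * w : ℝ) ≤ t := by
    calc ((2 * d + 1) * w : ℝ) ≤ 9 * (N ^ 3 * r * W) * w := by gcongr
      _ = 9 * N ^ 3 * w * r * W := by ring
      _ ≤ t := ht
  exact_mod_cast h5

theorem abs_dPr_unifWeight_sub_dPr_le_exp {κ : Type*} [Fintype κ] [DecidableEq κ] {K : ℝ}
    (hK : 0 ≤ K) {N r v w a t : ℕ} (hN : K + 100 ≤ N) (hr : 1 ≤ r) (ha : 1 ≤ a)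
    (hwa : (w : ℝ) ≤ a * r ^ 2) (hvK : (v : ℝ) ≤ K * w * 2 ^ w)
    (ht : ∀ d, d ≤ a + N ^ 3 * r ^ 3 * a → (2 * d + 1) * w ≤ t)
    {P : Fin r → Fin v → Finset κ} (hP : ∀ α j, #(P α j) = w)
    (hdisj : ∀ α i j, i ≠ j → Disjoint (P α i) (P α j))
    {D : (κ → Bool) → ℝ} (hD0 : ∀ x, 0 ≤ D x) (hD : kWiseIndep D t) :
    |dPr (unifWeight κ) (fun x => ¬ ∃ c : Fin r × Fin v, ∀ k ∈ P c.1 c.2, x k = true) -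
      dPr D (fun x => ¬ ∃ c : Fin r × Fin v, ∀ k ∈ P c.1 c.2, x k = true)| ≤
      Real.exp (-(a * r)) := by
  obtain ⟨q, hqd, hq0, hqx⟩ := exists_polynomial_weighted_le hK hN hr ha
  have hmean : Real.exp (v * ((Real.exp 1 - 1) * (1 / 2) ^ w)) ≤
      Real.exp (2 * K * a * r ^ 2) := by
    refine Real.exp_le_exp.mpr ((mean_mul_exp_le hvK).trans ?_)
    rw [mul_assoc (2 * K)]
    gcongr
  have hu0 : ∀ x, 0 ≤ unifWeight κ x := fun x => by
    unfold unifWeight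
    positivity
  have hle := abs_dPr_sub_dPr_le hu0 hD0 (kWiseIndep_unifWeight _ t) hD
    (A := fun c : Fin r × Fin v => P c.1 c.2) (fun c => (hP c.1 c.2).le) hq0 (ht _ hqd)
  have havg := (sum_unifWeight_mul_exp_average_le hr hP hdisj).trans hmean
  generalize (fun c : Fin r × Fin v => P c.1 c.2) = A at hle havg
  calc _ ≤ ∑ x, unifWeight κ x * (termCount A x * q.eval (termCount A x) ^ 2) := hle
    _ ≤ ∑ x, unifWeight κ x * (1 / 2 * Real.exp (-(a * r)) +
        1 / 2 * Real.exp (-(a * r + 2 * K * a * r ^ 2)) * Real.exp (termCount A x / r)) := by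
        refine Finset.sum_le_sum fun x _ => mul_le_mul_of_nonneg_left ?_ (hu0 x)
        obtain ⟨m, hm, -⟩ := exists_termCount_eq_natCast A x
        rw [hm]
        exact hqx m
    _ = 1 / 2 * Real.exp (-(a * r)) + 1 / 2 * Real.exp (-(a * r + 2 * K * a * r ^ 2)) *
        ∑ x, unifWeight κ x * Real.exp (termCount A x / r) := by
        simp only [mul_add, Finset.sum_add_distrib, ← Finset.sum_mul, sum_unifWeight, one_mul,
          mul_left_comm (unifWeight _ _), ← Finset.mul_sum]
    _ ≤ 1 / 2 * Real.exp (-(a * r)) + 1 / 2 * Real.exp (-(a * r + 2 * K * a * r ^ 2)) *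
        Real.exp (2 * K * a * r ^ 2) := by
        gcongr
    _ = Real.exp (-(a * r)) := by
        rw [mul_assoc, ← Real.exp_add, neg_add, neg_add_cancel_right]
        ring

theorem statement6 (K : ℝ) (hK : 1 ≤ K) :
    ∃ C : ℝ, 1 ≤ C ∧
      ∀ (r v w : ℕ) (P : Fin r → Fin v → Finset (Fin (v*w))) (ε : ℝ) (t : ℕ),
        0 < r → 0 < v → 0 < w →
        -- each `P α` is a partition of `[n]`, `n = v·w`, into `v` blocks of size `w`
        (∀ α j, (P α j).card = w) →
        (∀ α, ∀ i j, i ≠ j → Disjoint (P α i) (P α j)) →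
        (∀ α x, ∃ j, x ∈ P α j) →
        ((v:ℝ) ≤ K * w * 2^w) →
        0 < ε → ε < 1 →
        (C * w * r * (w + r * Real.logb 2 (1/ε) + (r:ℝ)^2) ≤ (t:ℝ)) →
        ∀ D : (Fin (v*w) → Bool) → ℝ, (∀ x, 0 ≤ D x) → (∑ x, D x) = 1 →
          kWiseIndep D t →
          |uPr (fun x : Fin (v*w) → Bool => ¬ ∃ α, TribesP (P α) x) -
            dPr D (fun x : Fin (v*w) → Bool => ¬ ∃ α, TribesP (P α) x)| ≤ ε := by
  classical
  set N : ℕ := ⌈K⌉₊ + 100 with hN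
  have hKN : K + 100 ≤ N := by
    rw [hN]
    push_cast
    linarith [Nat.le_ceil K]
  have hN1 : (1 : ℝ) ≤ N := by linarith
  have hN3 : (1 : ℝ) ≤ N ^ 3 := one_le_pow₀ hN1
  refine ⟨9 * N ^ 3, by linarith, ?_⟩
  intro r v w P ε t hr _ hw hcard hdisj _ hvK hε hε1 ht D hD0 _ hD
  have hw' : (1 : ℝ) ≤ w := by exact_mod_cast hw
  have hlog : -Real.log ε ≤ Real.logb 2 (1 / ε) := by
    have h0 : 0 ≤ -Real.log ε := by linarith [Real.log_nonpos hε.le hε1.le]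
    have h2 : Real.log 2 ≤ 1 := by linarith [Real.log_two_lt_d9]
    rw [Real.logb, one_div, Real.log_inv, le_div_iff₀ (Real.log_pos one_lt_two)]
    exact mul_le_of_le_one_right h0 h2
  have hL0 : 0 ≤ Real.logb 2 (1 / ε) := by linarith [Real.log_nonpos hε.le hε1.le]
  obtain ⟨a, ha1, hwa, hLa, haW⟩ := exists_scale (w := w) hr hL0
  have haε : Real.exp (-(a * r)) ≤ ε := by
    rw [← Real.le_log_iff_exp_le hε]
    linarith
  have hW : (1 : ℝ) ≤ w + r * Real.logb 2 (1 / ε) + (r : ℝ) ^ 2 := by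
    have h1 : 0 ≤ r * Real.logb 2 (1 / ε) := by positivity
    have h2 : (0 : ℝ) ≤ r ^ 2 := by positivity
    linarith
  have hE : (fun x : Fin (v * w) → Bool => ¬ ∃ α, TribesP (P α) x) =
      fun x => ¬ ∃ c : Fin r × Fin v, ∀ k ∈ P c.1 c.2, x k = true := by
    funext x
    simp only [TribesP, Prod.exists]
  rw [uPr_eq_dPr_unifWeight, hE]
  exact (abs_dPr_unifWeight_sub_dPr_le_exp (by linarith) hKN hr ha1 hwa hvK
    (fun d hd => two_mul_degree_add_one_mul_le (by omega) hr hW haW hd ht)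
    hcard hdisj hD0 hD).trans haε
end

section
/- There exists a universal constant C ≥ 1 such that the following holds. Let n = v·w and let 𝒫 = {P^1,…,P^u} be a collection of partitions of [n] into v blocks of size w that is (q,τ)-load balancing, with 1 ≤ q ≤ v, and let 0 < ε < 1. Then for every t ≥ C·w·log₂(1/ε), I_{q,t}(f_𝒫) ≤ ( u·(1 − 2^{−w})^{v−q} ) · ( τ·2^{−w} ) · q + 2·u·v·ε. -/
open Finset

/-- The event (on assignments to coordinates outside `Q`) that `F` is not determined. -/
def UndetC {n : ℕ} (F : (Fin n → Bool) → Prop) (Q : Finset (Fin n))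
    (x : {i : Fin n // i ∉ Q} → Bool) : Prop :=
  ∃ y z : Fin n → Bool, (∀ i, ∀ h : i ∉ Q, y i = x ⟨i, h⟩) ∧
    (∀ i, ∀ h : i ∉ Q, z i = x ⟨i, h⟩) ∧ ¬(F y ↔ F z)

section Probability

variable {α : Type*} [Fintype α] {D : α → ℝ}

lemma dPr_mono (hD : ∀ x, 0 ≤ D x) {E F : α → Prop} (h : ∀ x, E x → F x) :
    dPr D E ≤ dPr D F := by
  classical
  unfold dPr
  refine sum_le_sum fun x _ => ?_
  by_cases hE : E x
  · simp [hE, h x hE]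
  · by_cases hF : F x <;> simp [hE, hF, hD x]

lemma dPr_nonneg (hD : ∀ x, 0 ≤ D x) (E : α → Prop) : 0 ≤ dPr D E := by
  classical
  unfold dPr
  refine sum_nonneg fun x _ => ?_
  split_ifs
  · exact hD x
  · exact le_rfl

lemma dPr_le_sum (hD : ∀ x, 0 ≤ D x) (E : α → Prop) : dPr D E ≤ ∑ x, D x := by
  classical
  unfold dPr
  refine sum_le_sum fun x _ => ?_
  split_ifs
  · exact le_rfl
  · exact hD x

lemma dPr_and_not (D : α → ℝ) (E F : α → Prop) :
    dPr D (fun x => E x ∧ ¬ F x) = dPr D E - dPr D (fun x => E x ∧ F x) := by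
  classical
  unfold dPr
  rw [← sum_sub_distrib]
  refine sum_congr rfl fun x _ => ?_
  by_cases hE : E x <;> by_cases hF : F x <;> simp [hE, hF]

lemma dPr_exists_le {κ : Type*} [Fintype κ] (hD : ∀ x, 0 ≤ D x) (E : κ → α → Prop) :
    dPr D (fun x => ∃ i, E i x) ≤ ∑ i, dPr D (E i) := by
  classical
  unfold dPr
  rw [sum_comm]
  refine sum_le_sum fun x _ => ?_
  have hnn : ∀ i ∈ (univ : Finset κ), 0 ≤ if E i x then D x else 0 := by
    intro i _
    split_ifs
    · exact hD x
    · exact le_rfl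
  split_ifs with h
  · obtain ⟨i, hi⟩ := h
    calc D x = if E i x then D x else 0 := by simp [hi]
      _ ≤ _ := single_le_sum hnn (mem_univ i)
  · exact sum_nonneg hnn

end Probability

section Fooling

variable {ι : Type*} [Fintype ι] [DecidableEq ι] {D : (ι → Bool) → ℝ} {t : ℕ}

lemma kWiseIndep.dPr_forall_true (h : kWiseIndep D t) {A : Finset ι} (hA : A.card ≤ t) :
    dPr D (fun x => ∀ i ∈ A, x i = true) = (1 / 2 : ℝ) ^ A.card := by
  unfold dPr
  convert h A hA fun _ => true

/-- Bounded independence fools a conjunction of literals together with the negations of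
pairwise disjoint conjunctions of width `w`; the error is that of inclusion-exclusion truncated
at level `k`. -/
lemma kWiseIndep.abs_dPr_forall_true_and_sub_le (hD : ∀ x, 0 ≤ D x) (h : kWiseIndep D t)
    {κ : Type*} (B : κ → Finset ι) (w : ℕ) (s : Finset κ)
    (hcard : ∀ j ∈ s, (B j).card = w)
    (hdisj : ∀ i ∈ s, ∀ j ∈ s, i ≠ j → Disjoint (B i) (B j)) (A : Finset ι) (k : ℕ)
    (hAB : ∀ j ∈ s, Disjoint A (B j)) (ht : A.card + k * w ≤ t) :
    |dPr D (fun x => (∀ i ∈ A, x i = true) ∧ ∀ j ∈ s, ¬ ∀ i ∈ B j, x i = true) -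
        (1 / 2 : ℝ) ^ A.card * (1 - (1 / 2 : ℝ) ^ w) ^ s.card| ≤
      (1 / 2 : ℝ) ^ A.card * (s.card.choose k * ((1 / 2 : ℝ) ^ w) ^ k) := by
  classical
  have hp0 : (0 : ℝ) ≤ (1 / 2) ^ w := by positivity
  have hp1 : ((1 : ℝ) / 2) ^ w ≤ 1 := pow_le_one₀ (by norm_num) (by norm_num)
  induction s using Finset.induction_on generalizing A k with
  | empty =>
    have hA := h.dPr_forall_true (A := A) (by omega)
    simp only [notMem_empty, false_imp_iff, implies_true, and_true, card_empty, pow_zero,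
      mul_one, hA, sub_self, abs_zero]
    positivity
  | insert b s hb ih =>
    cases k with
    | zero =>
      have hA := h.dPr_forall_true (A := A) (by omega)
      have h1 : dPr D (fun x => (∀ i ∈ A, x i = true) ∧
          ∀ j ∈ insert b s, ¬ ∀ i ∈ B j, x i = true) ≤ (1 / 2 : ℝ) ^ A.card :=
        hA ▸ dPr_mono hD fun x hx => hx.1
      have h0 := dPr_nonneg hD (fun x => (∀ i ∈ A, x i = true) ∧
          ∀ j ∈ insert b s, ¬ ∀ i ∈ B j, x i = true)
      have hc : (0 : ℝ) ≤ (1 / 2 : ℝ) ^ A.card := by positivity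
      have hq0 : 0 ≤ (1 - (1 / 2 : ℝ) ^ w) ^ (insert b s).card := pow_nonneg (by linarith) _
      have hq1 : (1 - (1 / 2 : ℝ) ^ w) ^ (insert b s).card ≤ 1 :=
        pow_le_one₀ (by linarith) (by linarith)
      simp only [Nat.choose_zero_right, Nat.cast_one, pow_zero, mul_one]
      rw [abs_le]
      constructor <;> nlinarith
    | succ k =>
      have hcs : ∀ j ∈ s, (B j).card = w := fun j hj => hcard j (mem_insert_of_mem hj)
      have hds : ∀ i ∈ s, ∀ j ∈ s, i ≠ j → Disjoint (B i) (B j) := fun i hi j hj =>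
        hdisj i (mem_insert_of_mem hi) j (mem_insert_of_mem hj)
      have hAs : ∀ j ∈ s, Disjoint A (B j) := fun j hj => hAB j (mem_insert_of_mem hj)
      have hAb : Disjoint A (B b) := hAB b (mem_insert_self b s)
      have hU : (A ∪ B b).card = A.card + w := by
        rw [card_union_of_disjoint hAb, hcard b (mem_insert_self b s)]
      have hUs : ∀ j ∈ s, Disjoint (A ∪ B b) (B j) := fun j hj =>
        disjoint_union_left.2 ⟨hAs j hj, hdisj b (mem_insert_self b s) j (mem_insert_of_mem hj)
          (fun e => hb (e ▸ hj))⟩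
      have h1 := ih hcs hds A (k + 1) hAs ht
      have h2 := ih hcs hds (A ∪ B b) k hUs (by rw [hU]; linarith [add_mul k 1 w])
      have hsplit : dPr D (fun x => (∀ i ∈ A, x i = true) ∧
            ∀ j ∈ insert b s, ¬ ∀ i ∈ B j, x i = true) =
          dPr D (fun x => (∀ i ∈ A, x i = true) ∧ ∀ j ∈ s, ¬ ∀ i ∈ B j, x i = true) -
          dPr D (fun x => (∀ i ∈ A ∪ B b, x i = true) ∧
            ∀ j ∈ s, ¬ ∀ i ∈ B j, x i = true) := by
        have e1 : (fun x : ι → Bool => (∀ i ∈ A, x i = true) ∧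
            ∀ j ∈ insert b s, ¬ ∀ i ∈ B j, x i = true) =
            fun x => ((∀ i ∈ A, x i = true) ∧ ∀ j ∈ s, ¬ ∀ i ∈ B j, x i = true) ∧
              ¬ ∀ i ∈ B b, x i = true := by
          funext x
          rw [forall_mem_insert]
          exact propext (by tauto)
        have e2 : (fun x : ι → Bool => (∀ i ∈ A ∪ B b, x i = true) ∧
            ∀ j ∈ s, ¬ ∀ i ∈ B j, x i = true) =
            fun x => ((∀ i ∈ A, x i = true) ∧ ∀ j ∈ s, ¬ ∀ i ∈ B j, x i = true) ∧
              ∀ i ∈ B b, x i = true := by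
          funext x
          rw [forall_mem_union]
          exact propext (by tauto)
        rw [e1, e2, dPr_and_not]
      rw [hsplit, card_insert_of_notMem hb, Nat.choose_succ_succ']
      rw [hU, pow_add] at h2
      push_cast
      rw [abs_le] at h1 h2 ⊢
      rw [pow_succ] at h1 ⊢
      rw [pow_succ (1 - (1 / 2 : ℝ) ^ w)]
      constructor <;> linarith [h1.1, h1.2, h2.1, h2.2]

end Fooling

lemma choose_mul_pow_le_exp_neg {m w N : ℕ} (hm : m ≤ 2 ^ w * N) :
    (m.choose (4 * N) : ℝ) * ((1 / 2 : ℝ) ^ w) ^ (4 * N) ≤ Real.exp (-N) := by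
  have hx : (m : ℝ) * (1 / 2 : ℝ) ^ w ≤ N := by
    have : (m : ℝ) ≤ 2 ^ w * N := by exact_mod_cast hm
    calc (m : ℝ) * (1 / 2 : ℝ) ^ w ≤ (2 ^ w * N) * (1 / 2 : ℝ) ^ w := by gcongr
      _ = (2 * (1 / 2) : ℝ) ^ w * N := by rw [mul_pow]; ring
      _ = N := by norm_num
  have h1 := Real.pow_div_factorial_le_exp (Real.exp 1 * N) (by positivity) (4 * N)
  have he : Real.exp 1 < 3 := Real.exp_one_lt_three
  have h2 : Real.exp (Real.exp 1 * N) ≤ Real.exp ((4 * N : ℕ) * 1) * Real.exp (-N) := by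
    rw [← Real.exp_add]
    refine Real.exp_le_exp.2 ?_
    push_cast
    nlinarith [(Nat.cast_nonneg N : (0 : ℝ) ≤ N)]
  rw [mul_pow, mul_div_assoc] at h1
  rw [Real.exp_nat_mul] at h2
  have h3 := le_of_mul_le_mul_left (h1.trans h2) (by positivity)
  calc (m.choose (4 * N) : ℝ) * ((1 / 2 : ℝ) ^ w) ^ (4 * N)
      ≤ ((m : ℝ) ^ (4 * N) / (4 * N).factorial) * ((1 / 2 : ℝ) ^ w) ^ (4 * N) := by
        gcongr
        exact Nat.choose_le_pow_div _ _
    _ = ((m : ℝ) * (1 / 2 : ℝ) ^ w) ^ (4 * N) / (4 * N).factorial := by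
        rw [mul_pow]; ring
    _ ≤ (N : ℝ) ^ (4 * N) / (4 * N).factorial := by gcongr
    _ ≤ _ := h3

lemma one_sub_pow_two_pow_mul_le_exp_neg (w N : ℕ) :
    (1 - (1 / 2 : ℝ) ^ w) ^ (2 ^ w * N) ≤ Real.exp (-N) := by
  have hp1 : ((1 : ℝ) / 2) ^ w ≤ 1 := pow_le_one₀ (by norm_num) (by norm_num)
  calc (1 - (1 / 2 : ℝ) ^ w) ^ (2 ^ w * N)
      ≤ Real.exp (-(1 / 2 : ℝ) ^ w) ^ (2 ^ w * N) :=
        pow_le_pow_left₀ (by linarith) (Real.one_sub_le_exp_neg _) _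
    _ = Real.exp (-N) := by
        rw [← Real.exp_nat_mul]
        congr 1
        push_cast
        have : (2 : ℝ) ^ w * (1 / 2) ^ w = 1 := by rw [← mul_pow]; norm_num
        linear_combination (-(N : ℝ)) * this

lemma kWiseIndep.dPr_forall_true_and_le {ι : Type*} [Fintype ι] [DecidableEq ι]
    {D : (ι → Bool) → ℝ} {t : ℕ} (hD : ∀ x, 0 ≤ D x) (h : kWiseIndep D t)
    {κ : Type*} (B : κ → Finset ι) (w N r : ℕ) (s : Finset κ)
    (hcard : ∀ j ∈ s, (B j).card = w)
    (hdisj : ∀ i ∈ s, ∀ j ∈ s, i ≠ j → Disjoint (B i) (B j)) (A : Finset ι)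
    (hAB : ∀ j ∈ s, Disjoint A (B j)) (ht : A.card + 4 * N * w ≤ t) (hr : r ≤ s.card) :
    dPr D (fun x => (∀ i ∈ A, x i = true) ∧ ∀ j ∈ s, ¬ ∀ i ∈ B j, x i = true) ≤
      (1 / 2 : ℝ) ^ A.card * (1 - (1 / 2 : ℝ) ^ w) ^ r + 2 * Real.exp (-N) := by
  obtain ⟨s', hs', hc⟩ := exists_subset_card_eq (min_le_left s.card (2 ^ w * N))
  have hp0 : (0 : ℝ) ≤ (1 / 2) ^ w := by positivity
  have hp1 : ((1 : ℝ) / 2) ^ w ≤ 1 := pow_le_one₀ (by norm_num) (by norm_num)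
  have hmain := (abs_le.1 (h.abs_dPr_forall_true_and_sub_le hD B w s'
    (fun j hj => hcard j (hs' hj)) (fun i hi j hj => hdisj i (hs' hi) j (hs' hj)) A (4 * N)
    (fun j hj => hAB j (hs' hj)) ht)).2
  have hmono := dPr_mono hD
    (E := fun x => (∀ i ∈ A, x i = true) ∧ ∀ j ∈ s, ¬ ∀ i ∈ B j, x i = true)
    (F := fun x => (∀ i ∈ A, x i = true) ∧ ∀ j ∈ s', ¬ ∀ i ∈ B j, x i = true)
    (fun x hx => ⟨hx.1, fun j hj => hx.2 j (hs' hj)⟩)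
  have hch := choose_mul_pow_le_exp_neg (hc.trans_le (min_le_right s.card (2 ^ w * N)))
  have hprod : (1 - (1 / 2 : ℝ) ^ w) ^ s'.card ≤
      (1 - (1 / 2 : ℝ) ^ w) ^ r + Real.exp (-N) := by
    rcases le_total s.card (2 ^ w * N) with hle | hle
    · rw [hc, min_eq_left hle]
      have := pow_le_pow_of_le_one (sub_nonneg.2 hp1) (by linarith) hr
      linarith [Real.exp_pos (-N)]
    · rw [hc, min_eq_right hle]
      have := one_sub_pow_two_pow_mul_le_exp_neg w N
      linarith [pow_nonneg (sub_nonneg.2 hp1) r]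
  have hA0 : (0 : ℝ) ≤ (1 / 2) ^ A.card := by positivity
  have hA1 : ((1 : ℝ) / 2) ^ A.card ≤ 1 := pow_le_one₀ (by norm_num) (by norm_num)
  have h1 := mul_le_mul_of_nonneg_left hprod hA0
  have h2 := mul_le_mul_of_nonneg_left hch hA0
  have h3 := mul_le_mul_of_nonneg_right hA1 (Real.exp_pos (-N)).le
  linarith

/-- If a conjunction of Tribes functions is not determined, then one of them has a block meeting
`Q` that is satisfied outside `Q`, and no satisfied block avoiding `Q`. -/
lemma UndetC.exists_block {n u v : ℕ} {P : Fin u → Fin v → Finset (Fin n)}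
    {Q : Finset (Fin n)} {x : {i : Fin n // i ∉ Q} → Bool}
    (h : UndetC (fun x => ∀ α, TribesP (P α) x) Q x) :
    ∃ α j, (Q ∩ P α j).Nonempty ∧ (∀ i ∈ (P α j).subtype (· ∉ Q), x i = true) ∧
      ∀ j' ∈ univ.filter (fun j' => Q ∩ P α j' = ∅),
        ¬ ∀ i ∈ (P α j').subtype (· ∉ Q), x i = true := by
  obtain ⟨y, z, hy, hz, hne⟩ := h
  wlog hyz : (∀ α, TribesP (P α) y) ∧ ¬ ∀ α, TribesP (P α) z generalizing y z with H
  · exact H z y hz hy (fun e => hne e.symm) (by tauto)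
  obtain ⟨h1, h0⟩ := hyz
  push Not at h0
  obtain ⟨α, h0⟩ := h0
  have key : ∀ j, Q ∩ P α j = ∅ → ¬ ∀ i ∈ (P α j).subtype (· ∉ Q), x i = true := by
    intro j hj hx
    refine h0 ⟨j, fun k hk => ?_⟩
    have hkQ : k ∉ Q := fun hkQ => by
      simpa [hj] using mem_inter.2 ⟨hkQ, hk⟩
    rw [hz k hkQ]
    exact hx _ (mem_subtype.2 hk)
  obtain ⟨j, hj⟩ := h1 α
  have hxj : ∀ i ∈ (P α j).subtype (· ∉ Q), x i = true := fun i hi => by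
    rw [← hj i (mem_subtype.1 hi), hy i i.2]
  refine ⟨α, j, ?_, hxj, fun j' hj' => key j' (mem_filter.1 hj').2⟩
  rw [nonempty_iff_ne_empty]
  exact fun e => key j e hxj

lemma sub_le_card_filter_inter_eq_empty {n v q : ℕ} {P : Fin v → Finset (Fin n)}
    (hdisj : ∀ i j, i ≠ j → Disjoint (P i) (P j)) {Q : Finset (Fin n)} (hQ : Q.card ≤ q) :
    v - q ≤ (univ.filter fun j => Q ∩ P j = ∅).card := by
  have h1 := card_filter_add_card_filter_not (s := (univ : Finset (Fin v)))
    (fun j => Q ∩ P j = ∅)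
  have h2 : (univ.filter fun j => ¬ Q ∩ P j = ∅).card ≤ Q.card := by
    calc (univ.filter fun j => ¬ Q ∩ P j = ∅).card
        ≤ ∑ j ∈ univ.filter (fun j => ¬ Q ∩ P j = ∅), (Q ∩ P j).card := by
          rw [card_eq_sum_ones]
          refine sum_le_sum fun j hj => ?_
          exact card_pos.2 (nonempty_iff_ne_empty.2 (mem_filter.1 hj).2)
      _ = ((univ.filter fun j => ¬ Q ∩ P j = ∅).biUnion fun j => Q ∩ P j).card :=
          (card_biUnion fun i _ j _ hij =>
            (hdisj i j hij).mono inter_subset_right inter_subset_right).symm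
      _ ≤ Q.card := card_le_card (biUnion_subset.2 fun j _ => inter_subset_left)
  rw [card_univ, Fintype.card_fin] at h1
  omega

lemma card_subtype_notMem_add {n : ℕ} (Q S : Finset (Fin n)) :
    (S.subtype (· ∉ Q)).card + (Q ∩ S).card = S.card := by
  rw [card_subtype, inter_comm, ← filter_mem_eq_inter, add_comm]
  exact card_filter_add_card_filter_not _

lemma disjoint_subtype {β : Type*} (p : β → Prop) [DecidablePred p] {S T : Finset β}
    (h : Disjoint S T) : Disjoint (S.subtype p) (T.subtype p) := by
  rw [Finset.disjoint_left] at h ⊢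
  exact fun i hi hi' => h (mem_subtype.1 hi) (mem_subtype.1 hi')

theorem statement8 :
    ∃ C : ℝ, 1 ≤ C ∧
      ∀ (u v w q : ℕ) (τ ε : ℝ) (P : Fin u → Fin v → Finset (Fin (v*w))),
        0 < u → 0 < v → 0 < w → 1 ≤ q → q ≤ v → 0 < ε → ε < 1 →
        -- `P α` is a partition of `[n]`, `n = v·w`, into `v` blocks of size `w`
        (∀ α j, (P α j).card = w) →
        (∀ α, ∀ i j, i ≠ j → Disjoint (P α i) (P α j)) →
        (∀ α x, ∃ j, x ∈ P α j) →
        -- `(q,τ)`-load balancing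
        (∀ Q : Finset (Fin (v*w)), Q.card ≤ q → ∀ j : Fin v,
          (∑ α : Fin u, if (Q ∩ P α j).Nonempty then (2:ℝ)^((Q ∩ P α j).card) else 0) / u ≤
            τ * q / v) →
        ∀ t : ℕ, (C * w * Real.logb 2 (1/ε) ≤ (t:ℝ)) →
        ∀ Q : Finset (Fin (v*w)), Q.card ≤ q →
          ∀ D : ({i : Fin (v*w) // i ∉ Q} → Bool) → ℝ,
            (∀ x, 0 ≤ D x) → (∑ x, D x) = 1 → kWiseIndep D t →
            dPr D (UndetC (fun x => ∀ α, TribesP (P α) x) Q) ≤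
              ((u : ℝ) * (1 - (1/2:ℝ)^w)^(v - q)) * (τ * (1/2:ℝ)^w) * q + 2 * u * v * ε := by
  refine ⟨10, by norm_num, ?_⟩
  intro u v w q τ ε P hu hv hw hq hqv hε hε1 hcard hdisj _ hload t ht Q hQ D hD hD1 hk
  have hp1 : ((1 : ℝ) / 2) ^ w ≤ 1 := pow_le_one₀ (by norm_num) (by norm_num)
  have hr0 : 0 ≤ (1 - (1 / 2 : ℝ) ^ w) ^ (v - q) := pow_nonneg (sub_nonneg.2 hp1) _
  have hu' : (1 : ℝ) ≤ u := by exact_mod_cast hu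
  have hv' : (1 : ℝ) ≤ v := by exact_mod_cast hv
  have hq' : (1 : ℝ) ≤ q := by exact_mod_cast hq
  have hτ : 0 ≤ τ := by
    have h := hload ∅ (by simp) ⟨0, hv⟩
    simp only [empty_inter, Finset.not_nonempty_empty, if_false, sum_const_zero, zero_div] at h
    rw [le_div_iff₀ (by linarith), zero_mul] at h
    exact nonneg_of_mul_nonneg_left h (by linarith)
  rcases le_or_gt (1 / 2) ε with hbig | hsmall
  · have h1 := dPr_le_sum hD (UndetC (fun x => ∀ α, TribesP (P α) x) Q)
    have huv : (1 : ℝ) ≤ u * v := by nlinarith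
    have h2 : 0 ≤ ((u : ℝ) * (1 - (1/2:ℝ)^w)^(v - q)) * (τ * (1/2:ℝ)^w) * q := by positivity
    nlinarith
  set l := Real.logb 2 (1 / ε) with hl
  have hεinv : 2 ≤ 1 / ε := by rw [le_div_iff₀ hε]; linarith
  have hl1 : 1 ≤ l := by
    rw [hl, Real.le_logb_iff_rpow_le (by norm_num) (by positivity), Real.rpow_one]
    exact hεinv
  obtain ⟨N, hlN, hNl⟩ : ∃ N : ℕ, l ≤ N ∧ (N : ℝ) ≤ 2 * l :=
    ⟨⌈l⌉₊, Nat.le_ceil l, by linarith [Nat.ceil_lt_add_one (by linarith : 0 ≤ l)]⟩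
  have hexp : Real.exp (-N) ≤ ε := by
    have hlog : Real.log (1 / ε) ≤ l := by
      rw [hl, Real.logb, le_div_iff₀ (Real.log_pos (by norm_num))]
      have : 0 ≤ Real.log (1 / ε) := Real.log_nonneg (by linarith)
      nlinarith [Real.log_two_lt_d9]
    rw [one_div, Real.log_inv] at hlog
    calc Real.exp (-N) ≤ Real.exp (Real.log ε) := Real.exp_le_exp.2 (by linarith)
      _ = ε := Real.exp_log hε
  have htN : w + 4 * N * w ≤ t := by
    have hw' : (0 : ℝ) ≤ w := by positivity
    have h1N : (1 : ℝ) + 4 * N ≤ 10 * l := by linarith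
    have : (w : ℝ) + 4 * N * w ≤ t := by nlinarith [mul_le_mul_of_nonneg_right h1N hw']
    exact_mod_cast this
  let E (α : Fin u) (j : Fin v) (x : {i : Fin (v * w) // i ∉ Q} → Bool) : Prop :=
    (Q ∩ P α j).Nonempty ∧ (∀ i ∈ (P α j).subtype (· ∉ Q), x i = true) ∧
      ∀ j' ∈ univ.filter (fun j' => Q ∩ P α j' = ∅),
        ¬ ∀ i ∈ (P α j').subtype (· ∉ Q), x i = true
  have hE : ∀ α j, dPr D (E α j) ≤ (1 - (1 / 2 : ℝ) ^ w) ^ (v - q) * (1 / 2 : ℝ) ^ w *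
      (if (Q ∩ P α j).Nonempty then (2:ℝ)^((Q ∩ P α j).card) else 0) + 2 * ε := by
    intro α j
    split_ifs with hne
    · have hsum := card_subtype_notMem_add Q (P α j)
      rw [hcard] at hsum
      have h := hk.dPr_forall_true_and_le hD (fun j' => (P α j').subtype (· ∉ Q)) w N (v - q)
        (univ.filter fun j' => Q ∩ P α j' = ∅)
        (fun j' hj' => by
          have := card_subtype_notMem_add Q (P α j')
          rwa [(mem_filter.1 hj').2, card_empty, add_zero, hcard] at this)
        (fun i _ j' _ hij => disjoint_subtype _ (hdisj α i j' hij))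
        ((P α j).subtype (· ∉ Q))
        (fun j' hj' => disjoint_subtype _ (hdisj α j j' (by
          rintro rfl
          exact hne.ne_empty (mem_filter.1 hj').2)))
        (by omega) (sub_le_card_filter_inter_eq_empty (hdisj α) hQ)
      have hpow : (1 / 2 : ℝ) ^ ((P α j).subtype (· ∉ Q)).card =
          (1 / 2 : ℝ) ^ w * 2 ^ (Q ∩ P α j).card := by
        have hw2 : (1 / 2 : ℝ) ^ w = (1 / 2) ^ ((P α j).subtype (· ∉ Q)).card *
            (1 / 2) ^ (Q ∩ P α j).card := by rw [← pow_add, hsum]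
        rw [hw2, mul_assoc, ← mul_pow]
        norm_num
      rw [hpow] at h
      refine (dPr_mono hD fun x hx => hx.2).trans (h.trans ?_)
      linarith
    · have : dPr D (E α j) = 0 := by simp [dPr, E, hne]
      rw [this]
      linarith
  have hj : ∀ j, (∑ α : Fin u,
      if (Q ∩ P α j).Nonempty then (2:ℝ)^((Q ∩ P α j).card) else 0) ≤ τ * q / v * u :=
    fun j => (div_le_iff₀ (by linarith)).1 (hload Q hQ j)
  calc dPr D (UndetC (fun x => ∀ α, TribesP (P α) x) Q)
      ≤ dPr D (fun x => ∃ α, ∃ j, E α j x) := dPr_mono hD fun x hx => hx.exists_block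
    _ ≤ ∑ α, dPr D (fun x => ∃ j, E α j x) := dPr_exists_le hD _
    _ ≤ ∑ α, ∑ j, dPr D (E α j) := sum_le_sum fun α _ => dPr_exists_le hD _
    _ ≤ ∑ α, ∑ j, ((1 - (1 / 2 : ℝ) ^ w) ^ (v - q) * (1 / 2 : ℝ) ^ w *
          (if (Q ∩ P α j).Nonempty then (2:ℝ)^((Q ∩ P α j).card) else 0) + 2 * ε) :=
        sum_le_sum fun α _ => sum_le_sum fun j _ => hE α j
    _ = (1 - (1 / 2 : ℝ) ^ w) ^ (v - q) * (1 / 2 : ℝ) ^ w * (∑ j, ∑ α,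
          (if (Q ∩ P α j).Nonempty then (2:ℝ)^((Q ∩ P α j).card) else 0)) + 2 * u * v * ε := by
        rw [sum_comm]
        simp only [sum_add_distrib, ← mul_sum, sum_const, card_univ, Fintype.card_fin,
          nsmul_eq_mul]
        ring
    _ ≤ (1 - (1 / 2 : ℝ) ^ w) ^ (v - q) * (1 / 2 : ℝ) ^ w * (∑ _j : Fin v, τ * q / v * u) +
          2 * u * v * ε := by
        gcongr with j
        exact hj j
    _ = _ := by
        rw [sum_const, card_univ, Fintype.card_fin, nsmul_eq_mul]
        field_simp
end
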